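/- The Hall product on H is associative and δ_∅ is a two-sided unit: for all rooted forests A, B, C one has (δ_A × δ_B) × δ_C = δ_A × (δ_B × δ_C) and δ_∅ × δ_A = δ_A × δ_∅ = δ_A. Hence H is an associative unital ℚ-algebra. -/

import Mathlib

open scoped Classical

/-- Concrete (labeled) rooted trees: a root with a list of subtrees. -/
inductive RTree : Type
  | node : List RTree → RTree

/-- Shapes of admissible cuts: at each tree, either the full cut
(everything, including the root, goes to the pruned part `P`), or a choice of
an admissible cut of each child subtree.  A `full` occurring strictly inside
corresponds to cutting the edge above that vertex. -/
inductive CutShape : Type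
  | full
  | branch : List CutShape → CutShape

namespace CK

/-- Number of vertices of a forest. -/
def sizeL : List RTree → ℕ
  | [] => 0
  | .node l :: ts => 1 + sizeL l + sizeL ts

/-- All admissible cuts of a forest (a choice of admissible cut of each tree). -/
def cutsF : List RTree → List (List CutShape)
  | [] => [[]]
  | .node l :: ts =>
      (CutShape.full :: (cutsF l).map CutShape.branch).flatMap
        fun c => (cutsF ts).map (c :: ·)

/-- The root part `R_C(F)` of a cut. -/
def Rcut : List RTree → List CutShape → List RTree
  | [], _ => []
  | _ :: _, [] => []
  | .node _ :: ts, .full :: cs => Rcut ts cs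
  | .node l :: ts, .branch ds :: cs => RTree.node (Rcut l ds) :: Rcut ts cs

/-- The pruned part `P_C(F)` of a cut. -/
def Pcut : List RTree → List CutShape → List RTree
  | [], _ => []
  | _ :: _, [] => []
  | .node l :: ts, .full :: cs => RTree.node l :: Pcut ts cs
  | .node l :: ts, .branch ds :: cs => Pcut l ds ++ Pcut ts cs

/-- Number of `full`s occurring in a cut. -/
def fullsL : List CutShape → ℕ
  | [] => 0
  | .full :: cs => 1 + fullsL cs
  | .branch ds :: cs => fullsL ds + fullsL cs

/-- A list of concrete forests containing (representatives of) every forest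
with at most `n` vertices. -/
def forestsUpTo : ℕ → List (List RTree)
  | 0 => [[]]
  | n+1 => [] :: (forestsUpTo n).flatMap fun l => (forestsUpTo n).map fun F => RTree.node l :: F

/-- Isomorphism of rooted trees (non-planar): a root-preserving bijection, i.e.
the lists of subtrees agree up to permutation and isomorphism. -/
inductive Iso : RTree → RTree → Prop
  | node {l₁ l l₂ : List RTree} : List.Forall₂ Iso l₁ l → l.Perm l₂ → Iso (.node l₁) (.node l₂)

/-- Isomorphism classes of rooted trees. -/
abbrev TreeClass : Type := Quot Iso

/-- Isomorphism classes of rooted forests = multisets of tree classes.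
The empty forest is `0`. -/
abbrev ForestClass : Type := Multiset TreeClass

/-- Isomorphism class of a tree. -/
def clT (t : RTree) : TreeClass := Quot.mk _ t

/-- Isomorphism class of a forest. -/
def clF (F : List RTree) : ForestClass := (F.map clT : List TreeClass)

/-- A concrete representative of a forest class. -/
noncomputable def repF (M : ForestClass) : List RTree := M.toList.map Quot.out

/-- A concrete representative of a tree class. -/
noncomputable def repT (T : TreeClass) : RTree := T.out

/-- Number of vertices of a forest class. -/
noncomputable def sizeC (M : ForestClass) : ℕ := sizeL (repF M)

/-- Number of vertices of a tree class. -/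
noncomputable def sizeT (T : TreeClass) : ℕ := sizeL [repT T]

/-- The Hall algebra `H`: finitely supported ℚ-valued functions on
isomorphism classes of rooted forests, with basis the delta functions. -/
abbrev H : Type := ForestClass →₀ ℚ

/-- The basis element `δ_A` of `H`. -/
noncomputable def delta (A : ForestClass) : H := Finsupp.single A 1

/-- `n(A,B;M)`: the number of admissible cuts `C` of `M` with
`P_C(M) ≅ A` and `R_C(M) ≅ B`. -/
noncomputable def nCuts (A B M : ForestClass) : ℕ :=
  (cutsF (repF M)).countP fun c =>
    decide (clF (Pcut (repF M) c) = A ∧ clF (Rcut (repF M) c) = B)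

/-- A finite set of forest classes containing all classes with at most `n`
vertices. -/
noncomputable def forestCand (n : ℕ) : Finset ForestClass :=
  ((forestsUpTo n).map clF).toFinset

/-- A finite set of tree classes containing all classes with at most `n+1`
vertices. -/
noncomputable def treeCand (n : ℕ) : Finset TreeClass :=
  ((forestsUpTo n).map fun F => clT (RTree.node F)).toFinset

/-- The Hall product on basis elements: `δ_A × δ_B = Σ_M n(A,B;M)·δ_M`
(every `M` with `n(A,B;M) ≠ 0` has exactly `sizeC A + sizeC B` vertices). -/
noncomputable def mulBasis (A B : ForestClass) : H :=
  ∑ M ∈ forestCand (sizeC A + sizeC B), (nCuts A B M : ℚ) • delta M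

/-- The Hall product on `H`, extended bilinearly from basis elements. -/
noncomputable def hmul (f g : H) : H :=
  f.sum fun A a => g.sum fun B b => (a * b) • mulBasis A B

/-- The Connes-Kreimer Lie algebra `n_T` (as a vector space): the span of
isomorphism classes of rooted trees. -/
abbrev nT : Type := TreeClass →₀ ℚ

/-- The basis element of `n_T` corresponding to a rooted tree `T`. -/
noncomputable def tau (T : TreeClass) : nT := Finsupp.single T 1

/-- `a(T₁,T₂;T)`: the number of edges `e` of `T` such that the single-edge cut
at `e` has pruned part `≅ T₁` and root part `≅ T₂`. -/
noncomputable def aCount (T₁ T₂ T : TreeClass) : ℕ :=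
  (cutsF [repT T]).countP fun c =>
    decide (fullsL c = 1 ∧ clF (Pcut [repT T] c) = ({T₁} : Multiset TreeClass)
      ∧ clF (Rcut [repT T] c) = ({T₂} : Multiset TreeClass))

/-- The grafting (pre-Lie) product on basis elements:
`T₁ * T₂ = Σ_T a(T₁,T₂;T)·T`. -/
noncomputable def graftBasis (T₁ T₂ : TreeClass) : nT :=
  ∑ T ∈ treeCand (sizeT T₁ + sizeT T₂), (aCount T₁ T₂ T : ℚ) • tau T

/-- The grafting (pre-Lie) product on `n_T`, extended bilinearly. -/
noncomputable def graft (x y : nT) : nT :=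
  x.sum fun T₁ a => y.sum fun T₂ b => (a * b) • graftBasis T₁ T₂

/-- The Connes-Kreimer bracket `[x,y] = x*y - y*x` on `n_T`. -/
noncomputable def ckBracket (x y : nT) : nT := graft x y - graft y x

/-- `Ẽ_A δ_B = Σ_C δ_{R_C(B)}`, the sum over admissible cuts `C` of `B` with
`P_C(B) ≅ A`. -/
noncomputable def elimBasis (A B : ForestClass) : H :=
  (((cutsF (repF B)).filter fun c => decide (clF (Pcut (repF B) c) = A)).map
    fun c => delta (clF (Rcut (repF B) c))).sum

/-- The elimination operator `E_A` (here on `H ≅ H*`, identifying `φ_B` with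
`δ_B`). -/
noncomputable def elim (A : ForestClass) : H →ₗ[ℚ] H :=
  Finsupp.lsum ℚ fun B => LinearMap.toSpanSingleton ℚ H (elimBasis A B)

/-- `Ẽ^top_A δ_B = Σ_C δ_{P_C(B)}`, the sum over admissible cuts `C` of `B`
with `R_C(B) ≅ A`. -/
noncomputable def topElimBasis (A B : ForestClass) : H :=
  (((cutsF (repF B)).filter fun c => decide (clF (Rcut (repF B) c) = A)).map
    fun c => delta (clF (Pcut (repF B) c))).sum

/-- The top-elimination operator `E^top_A`. -/
noncomputable def topElim (A : ForestClass) : H →ₗ[ℚ] H :=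
  Finsupp.lsum ℚ fun B => LinearMap.toSpanSingleton ℚ H (topElimBasis A B)

/-- `H ⊗ H`, realized as finitely supported functions on pairs of classes. -/
abbrev H2 : Type := (ForestClass × ForestClass) →₀ ℚ

/-- `Δ(δ_M) = Σ δ_A ⊗ δ_B`, the sum over ordered pairs `(A,B)` of classes with
`A ⊔ B ≅ M`. -/
noncomputable def deltaBasis (M : ForestClass) : H2 :=
  ∑ A ∈ M.powerset.toFinset, Finsupp.single (A, M - A) 1

/-- The coproduct `Δ : H → H ⊗ H`. -/
noncomputable def coprod : H →ₗ[ℚ] H2 :=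
  Finsupp.lsum ℚ fun M => LinearMap.toSpanSingleton ℚ H2 (deltaBasis M)

/-! ### Induction on forests, and isomorphism classes -/

theorem forest_ind {p : List RTree → Prop} (h0 : p [])
    (h1 : ∀ l ts, p l → p ts → p (RTree.node l :: ts)) : ∀ F, p F
  | [] => h0
  | .node l :: ts => h1 l ts (forest_ind h0 h1 l) (forest_ind h0 h1 ts)

theorem forall2_iso_refl (F : List RTree) : List.Forall₂ Iso F F := by
  induction F using forest_ind with
  | h0 => exact .nil
  | h1 l ts hl hts => exact .cons (.node hl (List.Perm.refl _)) hts

theorem clF_repF (M : ForestClass) : clF (repF M) = M := by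
  have : (clT ∘ Quot.out : TreeClass → TreeClass) = id := by
    funext x; exact Quot.out_eq x
  simp [clF, repF, this]

@[simp] theorem clF_nil : clF [] = 0 := rfl

theorem clF_cons (t : RTree) (F : List RTree) : clF (t :: F) = {clT t} + clF F := by
  simp [clF]

theorem clF_append (F G : List RTree) : clF (F ++ G) = clF F + clF G := by
  simp [clF]

theorem node_replace {a b : RTree} (h : clT a = clT b) (p s : List RTree) :
    clT (.node (p ++ a :: s)) = clT (.node (p ++ b :: s)) := by
  have h' := Quot.eqvGen_exact h
  induction h' with
  | rel x y hxy =>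
    apply Quot.sound
    exact .node (List.rel_append (forall2_iso_refl p) (.cons hxy (forall2_iso_refl s)))
      (List.Perm.refl _)
  | refl x => rfl
  | symm x y hxy ih => exact (ih h.symm).symm
  | trans x y z hxy hyz ih1 ih2 =>
    exact (ih1 (Quot.eqvGen_sound hxy)).trans (ih2 (Quot.eqvGen_sound hyz))

theorem node_map_eq (F G : List RTree) (h : F.map clT = G.map clT) (p : List RTree) :
    clT (.node (p ++ F)) = clT (.node (p ++ G)) := by
  induction F generalizing G p with
  | nil =>
    cases G with
    | nil => rfl
    | cons b G => simp at h
  | cons a F ih =>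
    cases G with
    | nil => simp at h
    | cons b G =>
      simp only [List.map_cons, List.cons.injEq] at h
      rw [node_replace h.1]
      have := ih G h.2 (p ++ [b])
      simpa using this

theorem exists_perm {F G : List RTree} (h : clF F = clF G) :
    ∃ G' : List RTree, F.map clT = G'.map clT ∧ G'.Perm G := by
  have h' : (F.map clT).Perm (G.map clT) := Multiset.coe_eq_coe.1 h
  have e := congrFun (congrFun (List.eq_map_comp_perm clT) (F.map clT)) G
  exact e.mpr h'

theorem node_congr {F G : List RTree} (h : clF F = clF G) :
    clT (.node F) = clT (.node G) := by
  obtain ⟨G', hG', hp⟩ := exists_perm h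
  have e : clT (.node F) = clT (.node G') := node_map_eq F G' hG' []
  rw [e]
  exact Quot.sound (.node (forall2_iso_refl G') hp)

/-- Grafting the trees of a forest class on a new root. -/
noncomputable def Bp (M : ForestClass) : TreeClass := clT (.node (repF M))

theorem Bp_clF (F : List RTree) : Bp (clF F) = clT (.node F) :=
  node_congr (clF_repF _)

/-! ### Sums over cuts -/

/-- The sum of `φ(P,R)` over the admissible cuts of a concrete forest. -/
noncomputable def S (F : List RTree) (φ : ForestClass → ForestClass → ℚ) : ℚ :=
  ((cutsF F).map fun c => φ (clF (Pcut F c)) (clF (Rcut F c))).sum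

theorem S_nil (φ) : S [] φ = φ 0 0 := by
  simp [S, cutsF, Pcut, Rcut]

theorem S_node_cons (l ts φ) : S (.node l :: ts) φ
    = S ts (fun P R => φ ({clT (.node l)} + P) R)
      + S l (fun P R => S ts (fun P' R' => φ (P + P') ({Bp R} + R'))) := by
  simp only [S, cutsF, List.flatMap_cons, List.map_append, List.sum_append, List.map_map,
    Function.comp_def, Pcut, Rcut, clF_cons, List.flatMap_map]
  congr 1
  generalize cutsF l = L
  induction L with
  | nil => simp
  | cons c L ih =>
    simp only [List.flatMap_cons, List.map_append, List.sum_append, ih, List.map_cons,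
      List.sum_cons, List.map_map, Function.comp_def, Pcut, Rcut, clF_cons, clF_append, Bp_clF]

theorem S_add (F φ ψ) : S F (fun P R => φ P R + ψ P R) = S F φ + S F ψ := by
  simp [S, List.sum_map_add]

theorem S_zero (F) : S F (fun _ _ => 0) = 0 := by
  simp [S]

theorem S_comm (F G) (φ : ForestClass → ForestClass → ForestClass → ForestClass → ℚ) :
    S F (fun P R => S G (fun P' R' => φ P R P' R'))
      = S G (fun P' R' => S F (fun P R => φ P R P' R')) := by
  simp only [S]
  generalize cutsF F = L
  induction L with
  | nil => simp
  | cons c L ih => simp [ih, List.sum_map_add]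

theorem S_single (l φ) : S [.node l] φ
    = φ {clT (.node l)} 0 + S l (fun P R => φ P {Bp R}) := by
  simp [S_node_cons, S_nil]

theorem S_cons (t ts φ) : S (t :: ts) φ
    = S [t] (fun P R => S ts (fun P' R' => φ (P + P') (R + R'))) := by
  cases t with
  | node l => simp [S_node_cons l ts, S_single]

theorem S_append (F G φ) : S (F ++ G) φ
    = S F (fun P R => S G (fun P' R' => φ (P + P') (R + R'))) := by
  induction F generalizing φ with
  | nil => simp [S_nil]
  | cons t F ih =>
    rw [List.cons_append, S_cons, S_cons t F]
    simp only [ih, add_assoc]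

theorem S_perm {F G : List RTree} (h : F.Perm G) : S F = S G := by
  induction h with
  | nil => rfl
  | @cons x l₁ l₂ _ ih => funext φ; rw [S_cons x l₁, S_cons x l₂, ih]
  | swap x y l =>
    funext φ
    rw [S_cons y, S_cons x]
    simp only [S_cons _ l]
    rw [S_comm]
    simp only [add_left_comm]
  | trans _ _ h1 h2 => exact h1.trans h2

theorem S_iso {t t' : RTree} (h : Iso t t') : S [t] = S [t'] := by
  refine Iso.rec (motive_1 := fun t t' _ => S [t] = S [t'])
    (motive_2 := fun l l' _ => S l = S l') ?_ ?_ ?_ h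
  · intro l₁ l l₂ hf hp ih
    funext φ
    have : clT (.node l₁) = clT (.node l₂) := Quot.sound (.node hf hp)
    rw [S_single, S_single, ih, S_perm hp, this]
  · rfl
  · intro a b l l' _ _ h1 h2
    funext φ
    rw [S_cons, S_cons b, h1, h2]

theorem S_clT {t t' : RTree} (h : clT t = clT t') : S [t] = S [t'] :=
  congrArg (Quot.lift (fun t => S [t]) fun _ _ => S_iso) h

theorem S_map_eq (F G : List RTree) (h : F.map clT = G.map clT) : S F = S G := by
  induction F generalizing G with
  | nil =>
    cases G with
    | nil => rfl
    | cons b G => simp at h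
  | cons a F ih =>
    cases G with
    | nil => simp at h
    | cons b G =>
      simp only [List.map_cons, List.cons.injEq] at h
      funext φ
      rw [S_cons a, S_cons b, S_clT h.1, ih G h.2]

theorem S_clF {F G : List RTree} (h : clF F = clF G) : S F = S G := by
  obtain ⟨G', hG', hp⟩ := exists_perm h
  exact (S_map_eq F G' hG').trans (S_perm hp)

/-- The sum of `φ(P,R)` over the admissible cuts of a forest class. -/
noncomputable def Sc (M : ForestClass) : (ForestClass → ForestClass → ℚ) → ℚ := S (repF M)

theorem Sc_clF (F) : Sc (clF F) = S F := S_clF (clF_repF _)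

theorem Sc_zero (φ) : Sc 0 φ = φ 0 0 := by
  rw [← clF_nil, Sc_clF, S_nil]; rfl

theorem Sc_add (M N φ) : Sc (M + N) φ
    = Sc M (fun P R => Sc N (fun P' R' => φ (P + P') (R + R'))) := by
  conv_lhs => rw [← clF_repF M, ← clF_repF N, ← clF_append, Sc_clF, S_append]
  rfl

theorem Sc_Bp (N φ) : Sc {Bp N} φ = φ {Bp N} 0 + Sc N (fun P R => φ P {Bp R}) := by
  have : ({Bp N} : ForestClass) = clF [.node (repF N)] := rfl
  rw [this, Sc_clF, S_single]; rfl

/-! ### Coassociativity -/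

theorem coassoc (F : List RTree) : ∀ φ : ForestClass → ForestClass → ForestClass → ℚ,
    S F (fun M R => Sc M (fun A B => φ A B R)) = S F (fun A N => Sc N (fun B C => φ A B C)) := by
  induction F using forest_ind with
  | h0 => intro φ; simp [S_nil, Sc_zero]
  | h1 l ts hl hts =>
    have ht : ∀ φ : ForestClass → ForestClass → ForestClass → ℚ,
        S [.node l] (fun M R => Sc M (fun A B => φ A B R))
          = S [.node l] (fun A N => Sc N (fun B C => φ A B C)) := by
      intro φ
      rw [S_single, S_single, hl]
      simp only [Sc_Bp, S_add, Sc_zero]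
      rw [← Bp_clF, Sc_Bp, Sc_clF, add_assoc]
    intro φ
    rw [S_cons, S_cons _ ts]
    simp only [Sc_add]
    have e1 : ∀ P R, S ts (fun P' R' => Sc P (fun A B => Sc P' (fun A' B' =>
          φ (A + A') (B + B') (R + R'))))
        = Sc P (fun A B => S ts (fun A' N' => Sc N' (fun B' C' =>
          φ (A + A') (B + B') (R + C')))) := by
      intro P R
      unfold Sc
      rw [S_comm]
      congr 1; funext A B
      exact hts (fun A' B' R' => φ (A + A') (B + B') (R + R'))
    simp only [e1]
    rw [ht (fun A B R => S ts (fun A' N' => Sc N' (fun B' C' =>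
          φ (A + A') (B + B') (R + C'))))]
    congr 1; funext A N
    unfold Sc
    rw [S_comm]

theorem counit_left (F : List RTree) : ∀ g : ForestClass → ℚ,
    S F (fun P R => if P = 0 then g R else 0) = g (clF F) := by
  induction F using forest_ind with
  | h0 => intro g; simp [S_nil]
  | h1 l ts hl hts =>
    intro g
    rw [S_cons, S_single]
    have e : ∀ P R, S ts (fun P' R' => if P + P' = 0 then g (R + R') else 0)
        = if P = 0 then g (R + clF ts) else 0 := by
      intro P R
      by_cases hP : P = 0
      · simp [hP, hts (fun R' => g (R + R'))]
      · simp [hP, S_zero]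
    simp only [e]
    rw [hl (fun R => g ({Bp R} + clF ts)), Bp_clF, clF_cons]
    simp

theorem counit_right (F : List RTree) : ∀ g : ForestClass → ℚ,
    S F (fun P R => if R = 0 then g P else 0) = g (clF F) := by
  induction F using forest_ind with
  | h0 => intro g; simp [S_nil]
  | h1 l ts hl hts =>
    intro g
    rw [S_cons, S_single]
    have e : ∀ P R, S ts (fun P' R' => if R + R' = 0 then g (P + P') else 0)
        = if R = 0 then g (P + clF ts) else 0 := by
      intro P R
      by_cases hP : R = 0
      · simp [hP, hts (fun R' => g (P + R'))]
      · simp [hP, S_zero]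
    simp only [e]
    simp [S_zero, clF_cons]

/-! ### Sizes -/

theorem sizeL_append (F G) : sizeL (F ++ G) = sizeL F + sizeL G := by
  induction F with
  | nil => simp [sizeL]
  | cons t F ih => cases t; simp [sizeL, ih]; omega

theorem sizeL_cons (t F) : sizeL (t :: F) = sizeL [t] + sizeL F := sizeL_append [t] F

theorem sizeL_perm {F G : List RTree} (h : F.Perm G) : sizeL F = sizeL G := by
  induction h with
  | nil => rfl
  | @cons x l₁ l₂ _ ih => rw [sizeL_cons x l₁, sizeL_cons x l₂, ih]
  | swap x y l => rw [sizeL_cons y (x :: l), sizeL_cons x l, sizeL_cons x (y :: l), sizeL_cons y l]; omega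
  | trans _ _ h1 h2 => exact h1.trans h2

theorem sizeL_iso {t t' : RTree} (h : Iso t t') : sizeL [t] = sizeL [t'] := by
  refine Iso.rec (motive_1 := fun t t' _ => sizeL [t] = sizeL [t'])
    (motive_2 := fun l l' _ => sizeL l = sizeL l') ?_ ?_ ?_ h
  · intro l₁ l l₂ hf hp ih
    simp [sizeL, ih, sizeL_perm hp]
  · rfl
  · intro a b l l' _ _ h1 h2
    rw [sizeL_cons, sizeL_cons b, h1, h2]

/-- Size of a tree class by lifting. -/
def szT : TreeClass → ℕ := Quot.lift (fun t => sizeL [t]) fun _ _ => sizeL_iso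

theorem sizeL_eq (F : List RTree) : sizeL F = ((clF F).map szT).sum := by
  induction F with
  | nil => simp [sizeL]
  | cons t F ih => rw [sizeL_cons, ih, clF_cons]; simp [szT, clT]

theorem sizeC_clF (F : List RTree) : sizeC (clF F) = sizeL F := by
  rw [sizeC, sizeL_eq, clF_repF, ← sizeL_eq]

theorem size_cut (F : List RTree) : ∀ c ∈ cutsF F,
    sizeL (Pcut F c) + sizeL (Rcut F c) = sizeL F := by
  induction F using forest_ind with
  | h0 => simp [Pcut, Rcut, sizeL]
  | h1 l ts hl hts =>
    intro c hc
    simp only [cutsF, List.mem_flatMap, List.mem_cons, List.mem_map] at hc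
    obtain ⟨x, hx, cs, hcs, rfl⟩ := hc
    have h2 := hts cs hcs
    rcases hx with rfl | ⟨ds, hds, rfl⟩
    · simp only [Pcut, Rcut, sizeL]; omega
    · have h1 := hl ds hds
      simp only [Pcut, Rcut, sizeL, sizeL_append]; omega

theorem mem_forestsUpTo (F : List RTree) : ∀ n, sizeL F ≤ n → F ∈ forestsUpTo n := by
  induction F using forest_ind with
  | h0 => intro n _; cases n <;> simp [forestsUpTo]
  | h1 l ts hl hts =>
    intro n hn
    simp only [sizeL] at hn
    cases n with
    | zero => omega
    | succ n =>
      simp only [forestsUpTo, List.mem_cons, List.mem_flatMap, List.mem_map]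
      exact .inr ⟨l, hl n (by omega), ts, hts n (by omega), rfl⟩

theorem mem_cand {A B M : ForestClass} (h : nCuts A B M ≠ 0) :
    M ∈ forestCand (sizeC A + sizeC B) := by
  obtain ⟨c, hc, h2⟩ := List.countP_pos_iff.1 (Nat.pos_of_ne_zero h)
  obtain ⟨rfl, rfl⟩ := of_decide_eq_true h2
  rw [sizeC_clF, sizeC_clF, size_cut _ _ hc]
  simp only [forestCand, List.mem_toFinset, List.mem_map]
  exact ⟨repF M, mem_forestsUpTo _ _ le_rfl, clF_repF M⟩

theorem mulBasis_apply (A B M : ForestClass) : mulBasis A B M = nCuts A B M := by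
  simp only [mulBasis, delta, Finsupp.finsetSum_apply, Finsupp.smul_apply, Finsupp.single_apply,
    smul_eq_mul, mul_ite, mul_one, mul_zero, Finset.sum_ite_eq']
  split_ifs with h
  · rfl
  · by_contra h'
    exact h (mem_cand fun h0 => h' (by simp [h0]))

theorem nCuts_eq (A B M : ForestClass) :
    (nCuts A B M : ℚ) = Sc M (fun P R => if P = A ∧ R = B then 1 else 0) := by
  simp only [nCuts, Sc, S]
  generalize cutsF (repF M) = L
  induction L with
  | nil => simp
  | cons c L ih =>
    rw [List.countP_cons, List.map_cons, List.sum_cons, ← ih]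
    push_cast
    rw [add_comm]
    simp

theorem S_mul (F a φ) : a * S F φ = S F (fun P R => a * φ P R) := by
  simp [S, List.sum_map_mul_left]

theorem S_sum {ι : Type*} (F) (s : Finset ι) (φ : ι → ForestClass → ForestClass → ℚ) :
    ∑ i ∈ s, S F (φ i) = S F (fun P R => ∑ i ∈ s, φ i P R) := by
  induction s using Finset.induction_on with
  | empty => simp [S_zero]
  | insert i s hi ih => simp [Finset.sum_insert hi, ih, S_add]

theorem hmul_apply (f g : H) (M : ForestClass) :
    hmul f g M = Sc M (fun P R => f P * g R) := by
  simp only [hmul, Finsupp.sum, Finsupp.finsetSum_apply, Finsupp.smul_apply, smul_eq_mul,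
    mulBasis_apply, nCuts_eq]
  unfold Sc
  simp only [S_mul, S_sum]
  congr 1; funext P R
  have : ∀ x ∈ f.support, ∑ i ∈ g.support, f x * g i * (if P = x ∧ R = i then 1 else 0)
      = if P = x then f x * g R else 0 := by
    intro x _
    by_cases h : P = x
    · simp only [h, true_and, mul_ite, mul_one, mul_zero, Finset.sum_ite_eq, if_true]
      split_ifs with h2
      · rfl
      · simp [Finsupp.notMem_support_iff.1 h2]
    · simp [h]
  rw [Finset.sum_congr rfl this, Finset.sum_ite_eq]
  split_ifs with h2
  · rfl
  · simp [Finsupp.notMem_support_iff.1 h2]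

theorem hmul_assoc (f g h : H) : hmul (hmul f g) h = hmul f (hmul g h) := by
  ext M
  simp only [hmul_apply]
  have := coassoc (repF M) (fun A B C => f A * g B * h C)
  unfold Sc at this ⊢
  simp only [S_mul, ← mul_assoc]
  simp only [mul_comm _ (h _), S_mul]
  simpa only [mul_comm _ (h _)] using this

theorem hmul_one_left (f : H) : hmul (delta 0) f = f := by
  ext M
  have := counit_left (repF M) f
  rw [clF_repF] at this
  rw [hmul_apply, ← this]
  unfold Sc
  congr 1; funext P R
  by_cases h : P = 0 <;> simp [delta, h]

theorem hmul_one_right (f : H) : hmul f (delta 0) = f := by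
  ext M
  have := counit_right (repF M) f
  rw [clF_repF] at this
  rw [hmul_apply, ← this]
  unfold Sc
  congr 1; funext P R
  by_cases h : R = 0 <;> simp [delta, h]

/-- The Hall product on `H` is associative and `δ_∅` is a
two-sided unit: for all rooted forests `A, B, C`,
`(δ_A × δ_B) × δ_C = δ_A × (δ_B × δ_C)` and `δ_∅ × δ_A = δ_A × δ_∅ = δ_A`.
Hence (by bilinearity) `H` is an associative unital ℚ-algebra. -/
theorem hall_algebra_associative_unital :
    (∀ A B C : ForestClass,
      hmul (hmul (delta A) (delta B)) (delta C)
        = hmul (delta A) (hmul (delta B) (delta C))) ∧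
    (∀ A : ForestClass,
      hmul (delta 0) (delta A) = delta A ∧ hmul (delta A) (delta 0) = delta A) ∧
    -- hence, on all of H:
    (∀ f g h : H, hmul (hmul f g) h = hmul f (hmul g h)) ∧
    (∀ f : H, hmul (delta 0) f = f ∧ hmul f (delta 0) = f) := by
  exact ⟨fun _ _ _ => hmul_assoc _ _ _, fun _ => ⟨hmul_one_left _, hmul_one_right _⟩,
    hmul_assoc, fun _ => ⟨hmul_one_left _, hmul_one_right _⟩⟩

end CK
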